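/- arXiv:0908.1119 — 3 statements merged into one kernel-verified Lean document; each statement's English description precedes it below -/
import Mathlib

section
/- Fix an integer l ≥ 1, positive integers r_1, …, r_l with r = r_1 + ⋯ + r_l, a real number a, and a real number δ > 0. For e ∈ ℤ let E(e) ⊆ ℤ^l be the set of tuples (e_1, …, e_l) with e_1 + ⋯ + e_l = e and a ≤ e_i / r_i < (e + δ)/r for all 1 ≤ i ≤ l. If e ∈ ℤ satisfies e ≥ a·r + (r − 1)·δ, then every tuple (e_1, …, e_l) ∈ E(e + r) satisfies e_i − r_i ≥ a·r_i for all 1 ≤ i ≤ l. -/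
/-- The set `E(e)` of tuples `(e_1, …, e_l) ∈ ℤ^l` with `e_1 + ⋯ + e_l = e` and
`a ≤ e_i / r_i < (e + δ)/r` (inequalities of real numbers) for all `i`, where
`r = r_1 + ⋯ + r_l`. -/
def Eset (l : ℕ) (r : Fin l → ℤ) (a δ : ℝ) (e : ℤ) : Set (Fin l → ℤ) :=
  {f | (∑ i, f i) = e ∧
    ∀ i, a ≤ (f i : ℝ) / (r i : ℝ) ∧
      (f i : ℝ) / (r i : ℝ) < ((e : ℝ) + δ) / (((∑ i, r i : ℤ)) : ℝ)}

/-- If `e ≥ a·r + (r − 1)·δ`, then every tuple `(e_1, …, e_l) ∈ E(e + r)` satisfies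
`e_i − r_i ≥ a·r_i` for all `1 ≤ i ≤ l`. -/
theorem mem_shifted_Eset_lower_bound (l : ℕ) (hl : 1 ≤ l) (r : Fin l → ℤ)
    (hr : ∀ i, 1 ≤ r i) (a δ : ℝ) (hδ : 0 < δ) (e : ℤ)
    (he : (e : ℝ) ≥ a * (((∑ i, r i : ℤ)) : ℝ) + ((((∑ i, r i : ℤ)) : ℝ) - 1) * δ) :
    ∀ f ∈ Eset l r a δ (e + ∑ i, r i), ∀ i, (f i : ℝ) - (r i : ℝ) ≥ a * (r i : ℝ) := by
  intro f hf i
  obtain ⟨hs, hb⟩ := hf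
  have hr' : ∀ j, (1 : ℝ) ≤ (r j : ℝ) := fun j => by exact_mod_cast hr j
  have hsR : ∑ j, (f j : ℝ) = (e : ℝ) + ∑ j, (r j : ℝ) := by exact_mod_cast hs
  have hle : (r i : ℝ) ≤ ∑ j, (r j : ℝ) :=
    Finset.single_le_sum (f := fun j => (r j : ℝ))
      (fun j _ => by linarith [hr' j]) (Finset.mem_univ i)
  push_cast at he hb
  set R : ℝ := ∑ j, (r j : ℝ) with hR
  have hRpos : 0 < R := by linarith [hr' i]
  obtain ⟨c, hc⟩ : ∃ c : ℝ, c = ((e : ℝ) + R + δ) / R := ⟨_, rfl⟩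
  have hcR : c * R = (e : ℝ) + R + δ := by rw [hc]; field_simp
  have hca : a + δ + 1 ≤ c := by
    rw [hc, le_div_iff₀ hRpos]; nlinarith
  have hnn : ∀ j, 0 ≤ c * (r j : ℝ) - (f j : ℝ) := fun j => by
    have h := (hb j).2
    rw [← hc, div_lt_iff₀ (by linarith [hr' j])] at h
    linarith
  have h1 : c * (r i : ℝ) - (f i : ℝ) ≤ ∑ j, (c * (r j : ℝ) - (f j : ℝ)) :=
    Finset.single_le_sum (f := fun j => c * (r j : ℝ) - (f j : ℝ))
      (fun j _ => hnn j) (Finset.mem_univ i)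
  rw [Finset.sum_sub_distrib, ← Finset.mul_sum, ← hR, hsR, hcR] at h1
  have h2 : (a + δ + 1) * (r i : ℝ) ≤ c * (r i : ℝ) :=
    mul_le_mul_of_nonneg_right hca (by linarith [hr' i])
  nlinarith [mul_le_mul_of_nonneg_left (hr' i) hδ.le]
end

section
/- Fix an integer l ≥ 1, positive integers r_1, …, r_l with r = r_1 + ⋯ + r_l, a real number a, and a real number δ > 0. For e ∈ ℤ let E(e) ⊆ ℤ^l be the set of tuples (e_1, …, e_l) with e_1 + ⋯ + e_l = e and a ≤ e_i / r_i < (e + δ)/r for all 1 ≤ i ≤ l. If e ∈ ℤ satisfies e ≥ a·r + (r − 1)·δ, then the map ι_e(e_1, …, e_l) = (e_1 + r_1, …, e_l + r_l) is a bijection from E(e) onto E(e + r). -/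
/-- If `e ≥ a·r + (r − 1)·δ`, then `ι_e(e_1, …, e_l) = (e_1 + r_1, …, e_l + r_l)` is a
bijection from `E(e)` onto `E(e + r)`. -/
theorem shift_bijOn (l : ℕ) (hl : 1 ≤ l) (r : Fin l → ℤ)
    (hr : ∀ i, 1 ≤ r i) (a δ : ℝ) (hδ : 0 < δ) (e : ℤ)
    (he : (e : ℝ) ≥ a * (((∑ i, r i : ℤ)) : ℝ) + ((((∑ i, r i : ℤ)) : ℝ) - 1) * δ) :
    Set.BijOn (fun (f : Fin l → ℤ) i => f i + r i)
      (Eset l r a δ e) (Eset l r a δ (e + ∑ i, r i)) := by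
  have hne : Nonempty (Fin l) := ⟨⟨0, hl⟩⟩
  have hrp : ∀ i, (1:ℝ) ≤ (r i : ℝ) := fun i => by exact_mod_cast hr i
  have hr0 : ∀ i, (0:ℝ) < (r i : ℝ) := fun i => lt_of_lt_of_le one_pos (hrp i)
  have hRZ : 0 < ∑ i, r i :=
    Finset.sum_pos (fun i _ => lt_of_lt_of_le one_pos (hr i)) Finset.univ_nonempty
  have hRs : ((∑ i, r i : ℤ) : ℝ) = ∑ i, (r i : ℝ) := by push_cast; rfl
  have hR : (0:ℝ) < ((∑ i, r i : ℤ) : ℝ) := by exact_mod_cast hRZ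
  generalize hRdef : (∑ i, r i) = R at *
  have hadd : ∀ (x : ℤ) i, ((x + r i : ℤ) : ℝ) / (r i : ℝ) = (x : ℝ) / (r i : ℝ) + 1 := by
    intro x i
    have := (hr0 i).ne'
    push_cast
    field_simp
  have hup : (((e + R : ℤ) : ℝ) + δ) / (R : ℝ) = ((e : ℝ) + δ) / (R : ℝ) + 1 := by
    have := hR.ne'
    push_cast
    field_simp
    ring
  refine ⟨?_, ?_, ?_⟩
  · rintro f ⟨hs, hf⟩
    refine ⟨?_, fun i => ?_⟩
    · simp only [Finset.sum_add_distrib, hs, hRdef]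
    · obtain ⟨h1, h2⟩ := hf i
      simp only [hRdef] at h2 ⊢
      rw [hadd, hup]
      constructor <;> linarith
  · intro f _ g _ h
    funext i
    have := congrFun h i
    simpa using this
  · rintro g ⟨hs, hg⟩
    refine ⟨fun i => g i - r i, ?_, by funext i; simp⟩
    have hsf : ∑ i, (g i - r i) = e := by
      rw [Finset.sum_sub_distrib, hs, hRdef]; ring
    have hlt : ∀ i, ((g i - r i : ℤ) : ℝ) / (r i : ℝ) < ((e : ℝ) + δ) / (R : ℝ) := by
      intro i
      have h2 := (hg i).2
      have h3 := hadd (g i - r i) i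
      rw [sub_add_cancel] at h3
      rw [hRdef, hup, h3] at h2
      linarith
    refine ⟨hsf, fun i => ⟨?_, by rw [hRdef]; exact hlt i⟩⟩
    set c : ℝ := ((e : ℝ) + δ) / (R : ℝ) with hc
    have hcR : c * (R : ℝ) = e + δ := by rw [hc]; field_simp
    have hnn : ∀ j, 0 ≤ c * (r j : ℝ) - ((g j - r j : ℤ) : ℝ) := by
      intro j
      have := (div_lt_iff₀ (hr0 j)).1 (hlt j)
      linarith
    have hsum : ∑ j, (c * (r j : ℝ) - ((g j - r j : ℤ) : ℝ)) = δ := by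
      rw [Finset.sum_sub_distrib, ← Finset.mul_sum, ← hRs, hcR, ← Int.cast_sum, hsf]
      ring
    have hi := Finset.single_le_sum (fun j _ => hnn j) (Finset.mem_univ i)
    rw [hsum] at hi
    have hac : a ≤ c - δ := by
      have : (a + δ) ≤ c := by
        rw [hc, le_div_iff₀ hR]; linarith
      linarith
    rw [le_div_iff₀ (hr0 i)]
    have h4 := mul_le_mul_of_nonneg_right hac (hr0 i).le
    have h5 := mul_le_mul_of_nonneg_left (hrp i) hδ.le
    linarith
end

section
/- Fix α = (r, e) ∈ ℤ_{≥1} × ℤ, a real number δ > 0, and a real number a. Then the set of all tuples consisting of an element α' ∈ ℤ_{≥1} × ℤ together with a finite sequence of nonempty finite sequences (η_{1,1}, …, η_{1,l_1}), …, (η_{n,1}, …, η_{n,l_n}) of elements of ℤ_{≥1} × ℤ (n ≥ 1, l_1, …, l_n ≥ 1) such that α' + Σ_{i=1}^{n} Σ_{j=1}^{l_i} η_{i,j} = α and a ≤ μ(α') < μ(η_{1,1}) = ⋯ = μ(η_{1,l_1}) < μ(η_{2,1}) = ⋯ = μ(η_{2,l_2}) < ⋯ < μ(η_{n,1}) = ⋯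 = μ(η_{n,l_n}) < μ_δ(α), is a finite set. -/
/-- The slope `μ(α) = e/r` of `α = (r, e)`, as a real number. -/
noncomputable def muSlope (α : ℤ × ℤ) : ℝ := (α.2 : ℝ) / (α.1 : ℝ)

/-- The `δ`-slope `μ_δ(α) = (e + δ)/r` of `α = (r, e)`, as a real number. -/
noncomputable def muSlopeD (δ : ℝ) (α : ℤ × ℤ) : ℝ := ((α.2 : ℝ) + δ) / (α.1 : ℝ)

/-- Finiteness of dependent sums of finite sets. -/
theorem finite_sigma_aux {ι : Type*} {β : ι → Type*} {s : Set ι} (hs : s.Finite)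
    {t : (i : ι) → Set (β i)} (ht : ∀ i, (t i).Finite) :
    {x : Sigma β | x.1 ∈ s ∧ x.2 ∈ t x.1}.Finite := by
  refine (hs.biUnion (t := fun i => Set.image (Sigma.mk i) (t i)) fun i _ => (ht i).image _).subset ?_
  rintro ⟨i, x⟩ ⟨hi, hx⟩
  simp only [Set.mem_iUnion]
  exact ⟨i, hi, x, hx, rfl⟩

/-- An element of bounded rank and bounded slope lies in a finite box. -/
theorem mem_box_aux (r : ℤ) (a M : ℝ) (x : ℤ × ℤ) (h1 : 1 ≤ x.1)
    (h2 : x.1 ≤ r) (ha : a ≤ muSlope x) (hM : muSlope x < M) :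
    x ∈ Set.Icc (1 : ℤ) r ×ˢ Set.Icc (-⌈(r : ℝ) * (|a| + |M|)⌉) ⌈(r : ℝ) * (|a| + |M|)⌉ := by
  have h1' : (1 : ℝ) ≤ x.1 := by exact_mod_cast h1
  have h2' : (x.1 : ℝ) ≤ r := by exact_mod_cast h2
  have hx : (x.2 : ℝ) = x.1 * muSlope x := by
    unfold muSlope
    field_simp
  have hab : |muSlope x| ≤ |a| + |M| := by
    have := neg_abs_le a
    have := le_abs_self M
    have := abs_nonneg a
    have := abs_nonneg M
    rw [abs_le]
    constructor <;> linarith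
  have hx2 : |(x.2 : ℝ)| ≤ r * (|a| + |M|) := by
    rw [hx, abs_mul, abs_of_pos (by linarith : (0 : ℝ) < x.1)]
    exact mul_le_mul h2' hab (abs_nonneg _) (by linarith)
  have hx3 := hx2.trans (Int.le_ceil _)
  rw [abs_le] at hx3
  exact ⟨⟨h1, h2⟩, by exact_mod_cast hx3.1, by exact_mod_cast hx3.2⟩

/-- Fix `α = (r, e) ∈ ℤ_{≥1} × ℤ`, a real `δ > 0` and a real `a`.  The set of tuples
consisting of `α' ∈ ℤ_{≥1} × ℤ` together with a finite sequence of nonempty finite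
sequences `(η_{i,1}, …, η_{i,l_i})`, `1 ≤ i ≤ n`, of elements of `ℤ_{≥1} × ℤ` such that
`α' + Σ_{i,j} η_{i,j} = α` and
`a ≤ μ(α') < μ(η_{1,·}) < μ(η_{2,·}) < ⋯ < μ(η_{n,·}) < μ_δ(α)`
(the slope being constant within each group), is finite. -/
theorem layered_decompositions_finite (r e : ℤ) (hr : 1 ≤ r)
    (δ : ℝ) (hδ : 0 < δ) (a : ℝ) :
    Set.Finite {p : (ℤ × ℤ) × Σ n : ℕ, Σ ln : Fin n → ℕ,
        (i : Fin n) → Fin (ln i) → ℤ × ℤ |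
      1 ≤ p.2.1 ∧
      (∀ i, 1 ≤ p.2.2.1 i) ∧
      1 ≤ p.1.1 ∧
      (∀ i j, 1 ≤ (p.2.2.2 i j).1) ∧
      (p.1 + ∑ i, ∑ j, p.2.2.2 i j) = (r, e) ∧
      a ≤ muSlope p.1 ∧
      (∀ i j, muSlope p.1 < muSlope (p.2.2.2 i j)) ∧
      (∀ i j j', muSlope (p.2.2.2 i j) = muSlope (p.2.2.2 i j')) ∧
      (∀ i i', i < i' → ∀ j j', muSlope (p.2.2.2 i j) < muSlope (p.2.2.2 i' j')) ∧
      (∀ i j, muSlope (p.2.2.2 i j) < muSlopeD δ (r, e))} := by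
  have hB : (Set.Icc (1 : ℤ) r ×ˢ Set.Icc (-⌈(r : ℝ) * (|a| + |muSlopeD δ (r, e)|)⌉)
      ⌈(r : ℝ) * (|a| + |muSlopeD δ (r, e)|)⌉).Finite :=
    (Set.finite_Icc _ _).prod (Set.finite_Icc _ _)
  refine (hB.prod (finite_sigma_aux (Set.finite_Iic r.toNat)
    (t := fun n => {x | x.1 ∈ Set.pi Set.univ (fun _ : Fin n => Set.Iic r.toNat) ∧
      x.2 ∈ Set.pi Set.univ (fun i : Fin n => Set.pi Set.univ (fun _ : Fin (x.1 i) =>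
        Set.Icc (1 : ℤ) r ×ˢ Set.Icc (-⌈(r : ℝ) * (|a| + |muSlopeD δ (r, e)|)⌉)
          ⌈(r : ℝ) * (|a| + |muSlopeD δ (r, e)|)⌉))})
    (fun n => finite_sigma_aux (Set.Finite.pi fun _ => Set.finite_Iic _)
      (t := fun ln => Set.pi Set.univ (fun i : Fin n => Set.pi Set.univ (fun _ : Fin (ln i) =>
        Set.Icc (1 : ℤ) r ×ˢ Set.Icc (-⌈(r : ℝ) * (|a| + |muSlopeD δ (r, e)|)⌉)
          ⌈(r : ℝ) * (|a| + |muSlopeD δ (r, e)|)⌉)))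
      (fun ln => Set.Finite.pi fun i => Set.Finite.pi fun _ => hB)))).subset ?_
  rintro ⟨x, n, ln, η⟩ ⟨hn, hln, hx1, hη1, hsum, hax, hxη, -, -, hηM⟩
  dsimp only at *
  have hs : x.1 + ∑ i, ∑ j, (η i j).1 = r := by
    have := congrArg Prod.fst hsum
    simpa [Prod.fst_sum] using this
  have hin : ∀ i, (ln i : ℤ) ≤ ∑ j, (η i j).1 := fun i => by
    have := Finset.sum_le_sum (s := Finset.univ) (fun j _ => hη1 i j)
    simpa using this
  have hout : ∀ i, ∑ j, (η i j).1 ≤ ∑ i, ∑ j, (η i j).1 := fun i =>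
    Finset.single_le_sum (f := fun i => ∑ j, (η i j).1)
      (fun i _ => (by positivity : (0 : ℤ) ≤ (ln i : ℤ)).trans (hin i)) (Finset.mem_univ i)
  have hone : ∀ i j, (η i j).1 ≤ ∑ j, (η i j).1 := fun i j =>
    Finset.single_le_sum (f := fun j => (η i j).1)
      (fun j _ => by have := hη1 i j; omega) (Finset.mem_univ j)
  have hnn : (n : ℤ) ≤ ∑ i, ∑ j, (η i j).1 := by
    have := Finset.sum_le_sum (s := Finset.univ) (f := fun _ : Fin n => (1 : ℤ))
      (g := fun i => ∑ j, (η i j).1)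
      (fun i _ => le_trans (by exact_mod_cast hln i) (hin i))
    simpa using this
  have hi0 : Fin n := ⟨0, hn⟩
  have hj0 : Fin (ln hi0) := ⟨0, hln hi0⟩
  refine ⟨mem_box_aux r a _ x hx1 (by omega) hax ((hxη hi0 hj0).trans (hηM hi0 hj0)), ?_, ?_, ?_⟩
  · simp only [Set.mem_Iic]
    omega
  · intro i _
    have := hin i
    have := hout i
    simp only [Set.mem_Iic]
    omega
  · intro i _ j _
    have := hone i j
    have := hout i
    exact mem_box_aux r a _ (η i j) (hη1 i j) (by omega) (hax.trans (hxη i j).le) (hηM i j)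
end
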